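/- arXiv:2605.25314 — 2 statements merged into one kernel-verified Lean document; each statement's English description precedes it below -/
import Mathlib

section
/- Let R be a commutative Noetherian ring of finite Krull dimension and let M be an R-module. Suppose that for every prime ideal 𝔭 ⊆ R and every integer i ≥ 1 one has Tor_i^R(κ(𝔭), M) = 0, where κ(𝔭) = Frac(R/𝔭) is the residue field of R at 𝔭. Then M is a flat R-module. -/
open CategoryTheory

open TensorProduct in
/-- If every element of `K` is a fraction with numerator in `N` and denominator in `S`, so is every
element of `K ⊗ P`, with numerator in `N ⊗ P`. -/
lemma exists_smul_mem_range_rTensor {R N K P : Type*} [CommRing R] [AddCommGroup N] [Module R N]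
    [AddCommGroup K] [Module R K] [AddCommGroup P] [Module R P] (S : Submonoid R)
    (j : N →ₗ[R] K) (hj : ∀ k, ∃ s ∈ S, ∃ n, j n = s • k) (y : K ⊗[R] P) :
    ∃ s ∈ S, ∃ z, j.rTensor P z = s • y := by
  induction y with
  | zero => exact ⟨1, S.one_mem, 0, by simp⟩
  | tmul k p =>
    obtain ⟨s, hs, n, hn⟩ := hj k
    exact ⟨s, hs, n ⊗ₜ p, by simp [hn, smul_tmul']⟩
  | add y₁ y₂ h₁ h₂ =>
    obtain ⟨s₁, hs₁, z₁, hz₁⟩ := h₁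
    obtain ⟨s₂, hs₂, z₂, hz₂⟩ := h₂
    exact ⟨s₁ * s₂, S.mul_mem hs₁ hs₂, s₂ • z₁ + s₁ • z₂, by
      rw [map_add, map_smul, map_smul, hz₁, hz₂]; module⟩

/-- Tensoring commutes in the two variables. -/
lemma LinearMap.rTensor_lTensor_apply {R N N' P P' : Type*} [CommRing R] [AddCommGroup N]
    [Module R N] [AddCommGroup N'] [Module R N'] [AddCommGroup P] [Module R P] [AddCommGroup P']
    [Module R P'] (f : N →ₗ[R] N') (d : P →ₗ[R] P') (x : TensorProduct R N P) :
    f.rTensor P' (d.lTensor N x) = d.lTensor N' (f.rTensor P x) := by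
  rw [← LinearMap.comp_apply, ← LinearMap.comp_apply, LinearMap.rTensor_comp_lTensor,
    LinearMap.lTensor_comp_rTensor]

section Exactness

variable {R : Type*} [CommRing R] {N' N N'' : Type*}
  [AddCommGroup N'] [Module R N'] [AddCommGroup N] [Module R N] [AddCommGroup N''] [Module R N'']
  {P₃ P₂ P₁ P₀ M : Type*} [AddCommGroup P₃] [Module R P₃] [AddCommGroup P₂] [Module R P₂]
  [AddCommGroup P₁] [Module R P₁] [AddCommGroup P₀] [Module R P₀] [AddCommGroup M] [Module R M]

/-- Exactness of `N ⊗ P₂ → N ⊗ P₁ → N ⊗ P₀` is stable under extensions in `N`. -/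
lemma Function.Exact.lTensor_of_extension [Module.Flat R P₀]
    {f : N' →ₗ[R] N} {g : N →ₗ[R] N''} (hf : Function.Injective f) (hfg : Function.Exact f g)
    (hg : Function.Surjective g) {e : P₂ →ₗ[R] P₁} {d : P₁ →ₗ[R] P₀} (hde : d ∘ₗ e = 0)
    (h' : Function.Exact (e.lTensor N') (d.lTensor N'))
    (h'' : Function.Exact (e.lTensor N'') (d.lTensor N'')) :
    Function.Exact (e.lTensor N) (d.lTensor N) := by
  have hcomp : ∀ z, d.lTensor N (e.lTensor N z) = 0 := fun z ↦ by
    rw [← LinearMap.comp_apply, ← LinearMap.lTensor_comp, hde]; simp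
  refine fun x ↦ ⟨fun hx ↦ ?_, ?_⟩
  · obtain ⟨z'', hz''⟩ := (h'' (g.rTensor P₁ x)).1 (by
      rw [← LinearMap.rTensor_lTensor_apply, hx, map_zero])
    obtain ⟨z, rfl⟩ := LinearMap.rTensor_surjective P₂ hg z''
    obtain ⟨u, hu⟩ := (rTensor_exact P₁ hfg hg (x - e.lTensor N z)).1 (by
      rw [map_sub, LinearMap.rTensor_lTensor_apply, hz'', sub_self])
    obtain ⟨w, rfl⟩ := (h' u).1 <| Module.Flat.rTensor_preserves_injective_linearMap f hf <| by
      rw [LinearMap.rTensor_lTensor_apply, hu, map_sub, hx, hcomp, sub_zero, map_zero]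
    refine ⟨f.rTensor P₂ w + z, ?_⟩
    rw [map_add, ← LinearMap.rTensor_lTensor_apply, hu, sub_add_cancel]
  · rintro ⟨z, rfl⟩
    exact hcomp z

/-- If `N` embeds into a localization `K` of it, exactness of `K ⊗ P₂ → K ⊗ P₁ → K ⊗ P₀` descends
to `N` as soon as the cokernels `Q s` of multiplication by `s` on `N` have no homology
in one degree higher. -/
lemma Function.Exact.lTensor_of_localization {K : Type*} [AddCommGroup K] [Module R K]
    {Q : R → Type*} [∀ s, AddCommGroup (Q s)] [∀ s, Module R (Q s)] [Module.Flat R P₁]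
    (S : Submonoid R)
    {j : N →ₗ[R] K} (hj : Function.Injective j) (hjS : ∀ k, ∃ s ∈ S, ∃ n, j n = s • k)
    (hreg : ∀ s ∈ S, IsSMulRegular N s)
    {g : ∀ s, N →ₗ[R] Q s} (hg : ∀ s ∈ S, Function.Surjective (g s))
    (hsg : ∀ s ∈ S, Function.Exact (LinearMap.lsmul R N s) (g s))
    {c : P₃ →ₗ[R] P₂} {e : P₂ →ₗ[R] P₁} {d : P₁ →ₗ[R] P₀}
    (hde : d ∘ₗ e = 0) (hec : e ∘ₗ c = 0)
    (hK : Function.Exact (e.lTensor K) (d.lTensor K))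
    (hN : ∀ s ∈ S, Function.Exact (c.lTensor (Q s)) (e.lTensor (Q s))) :
    Function.Exact (e.lTensor N) (d.lTensor N) := by
  refine fun x ↦ ⟨fun hx ↦ ?_, ?_⟩
  · obtain ⟨y, hy⟩ := (hK (j.rTensor P₁ x)).1 (by
      rw [← LinearMap.rTensor_lTensor_apply, hx, map_zero])
    obtain ⟨s, hs, y', hy'⟩ := exists_smul_mem_range_rTensor S j hjS y
    have hsx : s • x = e.lTensor N y' :=
      Module.Flat.rTensor_preserves_injective_linearMap j hj <| by
        rw [LinearMap.rTensor_lTensor_apply, hy', map_smul, map_smul, hy]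
    have hlsmul : LinearMap.lsmul R N s = s • LinearMap.id := by ext; simp
    obtain ⟨z', hz'⟩ := (hN s hs ((g s).rTensor P₂ y')).1 (by
      rw [← LinearMap.rTensor_lTensor_apply, ← hsx]
      exact (rTensor_exact P₁ (hsg s hs) (hg s hs) _).2 ⟨x, by
        rw [hlsmul, LinearMap.rTensor_smul, LinearMap.smul_apply, LinearMap.rTensor_id_apply]⟩)
    obtain ⟨z, rfl⟩ := LinearMap.rTensor_surjective P₃ (hg s hs) z'
    obtain ⟨w, hw⟩ := (rTensor_exact P₂ (hsg s hs) (hg s hs) (y' - c.lTensor N z)).1 (by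
      rw [map_sub, LinearMap.rTensor_lTensor_apply, hz', sub_self])
    refine ⟨w, (IsSMulRegular.rTensor P₁ (hreg s hs)) ?_⟩
    change s • _ = s • _
    have hcz : e.lTensor N (c.lTensor N z) = 0 := by
      rw [← LinearMap.comp_apply, ← LinearMap.lTensor_comp, hec]; simp
    rw [hlsmul, LinearMap.rTensor_smul, LinearMap.smul_apply, LinearMap.rTensor_id_apply] at hw
    rw [← map_smul, hw, map_sub, hcz, sub_zero, hsx]
  · rintro ⟨z, rfl⟩
    rw [← LinearMap.comp_apply, ← LinearMap.lTensor_comp, hde]; simp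

/-- If `P₂ → P₁ → P₀ → M → 0` is the start of a flat resolution, vanishing of the first homology
of `N'' ⊗ P` makes `N' ⊗ M → N ⊗ M` injective. -/
lemma LinearMap.rTensor_injective_of_exact [Module.Flat R P₀]
    {f : N' →ₗ[R] N} {g : N →ₗ[R] N''} (hf : Function.Injective f) (hfg : Function.Exact f g)
    (hg : Function.Surjective g) {e : P₂ →ₗ[R] P₁} {d : P₁ →ₗ[R] P₀} {ε : P₀ →ₗ[R] M}
    (hde : d ∘ₗ e = 0) (hdε : Function.Exact d ε) (hε : Function.Surjective ε)
    (h'' : Function.Exact (e.lTensor N'') (d.lTensor N'')) :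
    Function.Injective (f.rTensor M) := by
  rw [injective_iff_map_eq_zero]
  intro u hu
  obtain ⟨v, rfl⟩ := LinearMap.lTensor_surjective N' hε u
  rw [LinearMap.rTensor_lTensor_apply] at hu
  obtain ⟨w, hw⟩ := (lTensor_exact N hdε hε _).1 hu
  obtain ⟨z'', hz''⟩ := (h'' (g.rTensor P₁ w)).1 (by
    rw [← LinearMap.rTensor_lTensor_apply, hw]
    exact (rTensor_exact P₀ hfg hg).apply_apply_eq_zero v)
  obtain ⟨z, rfl⟩ := LinearMap.rTensor_surjective P₂ hg z''
  obtain ⟨t, ht⟩ := (rTensor_exact P₁ hfg hg (w - e.lTensor N z)).1 (by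
    rw [map_sub, LinearMap.rTensor_lTensor_apply, hz'', sub_self])
  have hez : d.lTensor N (e.lTensor N z) = 0 := by
    rw [← LinearMap.comp_apply, ← LinearMap.lTensor_comp, hde]; simp
  have htv : d.lTensor N' t = v := Module.Flat.rTensor_preserves_injective_linearMap f hf <| by
    rw [LinearMap.rTensor_lTensor_apply, ht, map_sub, hez, sub_zero, hw]
  rw [← htv]
  exact (lTensor_exact N' hdε hε).apply_apply_eq_zero t

end Exactness

section Quotients

variable {R : Type*} [CommRing R]

/-- `R ⧸ I → R ⧸ I → R ⧸ (I + a)`, with first map multiplication by `a`, is exact. -/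
lemma Ideal.exact_lsmul_factor (I : Ideal R) (a : R) :
    Function.Exact (LinearMap.lsmul R (R ⧸ I) a)
      (Submodule.factor (le_sup_left : I ≤ I ⊔ Ideal.span {a})) := by
  intro x
  obtain ⟨x, rfl⟩ := Submodule.mkQ_surjective _ x
  rw [Submodule.factor_mk, Submodule.mkQ_apply, Submodule.mkQ_apply,
    Submodule.Quotient.mk_eq_zero, Submodule.mem_sup]
  constructor
  · rintro ⟨i, hi, _, hj, rfl⟩
    obtain ⟨r, rfl⟩ := Ideal.mem_span_singleton'.1 hj
    refine ⟨Submodule.Quotient.mk r, ?_⟩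
    rw [LinearMap.lsmul_apply, ← Submodule.Quotient.mk_smul]
    refine (Submodule.Quotient.eq I).2 ?_
    simpa [mul_comm] using hi
  · rintro ⟨r, hr⟩
    obtain ⟨r, rfl⟩ := Submodule.mkQ_surjective _ r
    have hr' : a * r - x ∈ I := (Submodule.Quotient.eq I).1 hr
    exact ⟨x - a * r, by simpa using I.neg_mem hr', r * a, Ideal.mem_span_singleton'.2 ⟨r, rfl⟩,
      by ring⟩

/-- `R ⧸ (I : a) → R ⧸ I → R ⧸ (I + a)`, with first map multiplication by `a`, is left exact. -/
lemma Ideal.exact_mapQ_lsmul_factor (I : Ideal R) (a : R) :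
    Function.Injective (Submodule.mapQ (Submodule.comap (LinearMap.lsmul R R a) I) I
      (LinearMap.lsmul R R a) le_rfl) ∧
    Function.Exact (Submodule.mapQ (Submodule.comap (LinearMap.lsmul R R a) I) I
      (LinearMap.lsmul R R a) le_rfl)
      (Submodule.factor (le_sup_left : I ≤ I ⊔ Ideal.span {a})) := by
  constructor
  · rw [← LinearMap.ker_eq_bot, Submodule.ker_mapQ, Submodule.mkQ_map_self]
  · refine fun x ↦ (I.exact_lsmul_factor a x).trans ⟨?_, ?_⟩
    · rintro ⟨r, rfl⟩
      obtain ⟨r, rfl⟩ := Submodule.mkQ_surjective _ r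
      exact ⟨Submodule.Quotient.mk r, rfl⟩
    · rintro ⟨r, rfl⟩
      obtain ⟨r, rfl⟩ := Submodule.mkQ_surjective _ r
      exact ⟨Submodule.Quotient.mk r, rfl⟩

/-- Over a Noetherian ring, a complex of flat modules which is exact after tensoring with all
residue fields is exact after tensoring with all cyclic modules. -/
theorem Function.Exact.lTensor_quotient_of_residueField [IsNoetherianRing R]
    {P : ℕ → Type*} [∀ n, AddCommGroup (P n)] [∀ n, Module R (P n)] [∀ n, Module.Flat R (P n)]
    (d : ∀ n, P (n + 1) →ₗ[R] P n) (hd : ∀ n, d n ∘ₗ d (n + 1) = 0)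
    (hκ : ∀ 𝔭 : Ideal R, 𝔭.IsPrime → ∀ n,
      Function.Exact ((d (n + 1)).lTensor (FractionRing (R ⧸ 𝔭)))
        ((d n).lTensor (FractionRing (R ⧸ 𝔭))))
    (I : Ideal R) : ∀ n, Function.Exact ((d (n + 1)).lTensor (R ⧸ I)) ((d n).lTensor (R ⧸ I)) := by
  induction I using WellFoundedGT.induction with
  | ind I ih =>
  intro n
  have lt_sup {a : R} (ha : a ∉ I) : I < I ⊔ Ideal.span {a} :=
    lt_of_le_of_ne le_sup_left fun h ↦ ha <| by
      rw [h]; exact Ideal.mem_sup_right (Ideal.mem_span_singleton_self a)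
  by_cases hI : I.IsPrime
  · refine Function.Exact.lTensor_of_localization I.primeCompl
      (j := (Algebra.linearMap (R ⧸ I) (FractionRing (R ⧸ I))).restrictScalars R)
      (IsFractionRing.injective (R ⧸ I) (FractionRing (R ⧸ I))) ?_ ?_
      (g := fun s ↦ Submodule.factor (le_sup_left : I ≤ I ⊔ Ideal.span {s})) ?_ ?_
      (hd n) (hd (n + 1)) (hκ I hI n) ?_
    · intro k
      obtain ⟨x, ⟨s, hs⟩, rfl⟩ := IsLocalization.exists_mk'_eq (nonZeroDivisors (R ⧸ I)) k
      obtain ⟨s, rfl⟩ := Ideal.Quotient.mk_surjective s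
      refine ⟨s, fun h ↦ nonZeroDivisors.ne_zero hs (Ideal.Quotient.eq_zero_iff_mem.2 h), x, ?_⟩
      rw [← algebraMap_smul (R ⧸ I) s, Algebra.smul_def]
      exact (IsLocalization.mk'_spec' _ x ⟨_, hs⟩).symm
    · intro s hs
      rw [isSMulRegular_iff_right_eq_zero_of_smul]
      intro x hx
      rw [Algebra.smul_def] at hx
      exact (mul_eq_zero.1 hx).resolve_left fun h ↦ hs (Ideal.Quotient.eq_zero_iff_mem.1 h)
    · exact fun s _ ↦ Submodule.factor_surjective _
    · exact fun s _ ↦ I.exact_lsmul_factor s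
    · exact fun s hs ↦ ih _ (lt_sup hs) (n + 1)
  · by_cases htop : I = ⊤
    · subst htop
      intro x
      have := Ideal.Quotient.subsingleton_iff.2 (rfl : (⊤ : Ideal R) = ⊤)
      exact ⟨fun _ ↦ ⟨0, Subsingleton.elim _ _⟩, fun _ ↦ Subsingleton.elim _ _⟩
    · obtain ⟨a, ha, b, hb, hab⟩ : ∃ a, a ∉ I ∧ ∃ b, b ∉ I ∧ a * b ∈ I := by
        by_contra! h
        exact hI ⟨htop, fun {x y} hxy ↦ or_iff_not_imp_left.2 fun hx ↦ by
          by_contra hy; exact h x hx y hy hxy⟩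
      obtain ⟨hinj, hex⟩ := I.exact_mapQ_lsmul_factor a
      refine Function.Exact.lTensor_of_extension hinj hex
        (Submodule.factor_surjective _) (hd n) (ih _ ?_ n) (ih _ (lt_sup ha) n)
      refine lt_of_le_of_ne (fun x hx ↦ I.mul_mem_left a hx) fun h ↦ hb ?_
      rw [h]
      exact hab

/-- A module with a flat resolution which stays exact after tensoring with all residue fields is
flat. -/
theorem Module.Flat.of_flat_resolution_of_residueField [IsNoetherianRing R]
    {P : ℕ → Type*} [∀ n, AddCommGroup (P n)] [∀ n, Module R (P n)] [∀ n, Module.Flat R (P n)]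
    {M : Type*} [AddCommGroup M] [Module R M]
    (d : ∀ n, P (n + 1) →ₗ[R] P n) (hd : ∀ n, d n ∘ₗ d (n + 1) = 0)
    (ε : P 0 →ₗ[R] M) (hdε : Function.Exact (d 0) ε) (hε : Function.Surjective ε)
    (hκ : ∀ 𝔭 : Ideal R, 𝔭.IsPrime → ∀ n,
      Function.Exact ((d (n + 1)).lTensor (FractionRing (R ⧸ 𝔭)))
        ((d n).lTensor (FractionRing (R ⧸ 𝔭)))) :
    Module.Flat R M :=
  Module.Flat.iff_rTensor_injective'.2 fun I ↦
    LinearMap.rTensor_injective_of_exact I.injective_subtype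
      (LinearMap.exact_subtype_mkQ I) (Submodule.mkQ_surjective I) (hd 0) hdε hε
      (Function.Exact.lTensor_quotient_of_residueField d hd hκ I 0)

end Quotients

/-- Let `R` be a commutative Noetherian ring of finite Krull dimension and `M` an `R`-module.
If `Tor_i^R(κ(𝔭), M) = 0` for every prime ideal `𝔭 ⊆ R` and every `i ≥ 1`, where
`κ(𝔭) = Frac(R/𝔭)` is the residue field of `R` at `𝔭`, then `M` is a flat `R`-module. -/
theorem flat_of_tor_residue_fields_vanish
    (R : Type) [CommRing R] [IsNoetherianRing R]
    (hdim : ringKrullDim R < ⊤)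
    (M : Type) [AddCommGroup M] [Module R M]
    (htor : ∀ (𝔭 : Ideal R), 𝔭.IsPrime → ∀ i : ℕ, 0 < i →
      Limits.IsZero (((Tor (ModuleCat R) i).obj
        (ModuleCat.of R (FractionRing (R ⧸ 𝔭)))).obj (ModuleCat.of R M))) :
    Module.Flat R M := by
  let P := projectiveResolution (ModuleCat.of R M)
  have hflat : ∀ n, Module.Flat R (P.complex.X n) := fun n ↦
    have : Module.Projective R (P.complex.X n) :=
      (IsProjective.iff_projective _).2 (P.projective n)
    inferInstance
  refine Module.Flat.of_flat_resolution_of_residueField (P := fun n ↦ P.complex.X n)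
    (fun n ↦ (P.complex.d (n + 1) n).hom) (fun n ↦ ?_) (P.π.f 0).hom ?_ ?_ fun 𝔭 h𝔭 n ↦ ?_
  · rw [← ModuleCat.hom_comp, P.complex.d_comp_d]; rfl
  · exact (ShortComplex.ShortExact.moduleCat_exact_iff_function_exact _).1 P.exact₀
  · exact (ModuleCat.epi_iff_surjective (P.π.f 0)).1 inferInstance
  · have h := (htor 𝔭 h𝔭 (n + 1) n.succ_pos).of_iso
      (P.isoLeftDerivedObj ((MonoidalCategory.tensoringLeft (ModuleCat R)).obj
        (ModuleCat.of R (FractionRing (R ⧸ 𝔭)))) (n + 1)).symm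
    have h' := (HomologicalComplex.exactAt_iff_isZero_homology _ _).2 h
    rw [HomologicalComplex.exactAt_iff' _ (n + 2) (n + 1) n (by simp) (by simp)] at h'
    exact (ShortComplex.ShortExact.moduleCat_exact_iff_function_exact _).1 h'
end

section
/- Let f₁,…,f_r be nonzero linear functionals on ℂⁿ defining a central hyperplane arrangement which is essential and indecomposable. Then there exists a vector β = (β₁,…,β_r) ∈ ℚ^r adapted to the edge {0}: all β_i > 0, Σ_{i=1}^r β_i = n, for every dense edge W one has Σ_{i : W ⊆ ker f_i} β_i ≤ codim W, and for every dense edge W ≠ {0} one has Σ_{i : W ⊆ ker f_i} β_i ∉ ℤ. -/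
open scoped Classical

open Finset in
theorem LinearIndepOn.card_inter_le_finrank_span {K V ι : Type*} [Field K] [AddCommGroup V]
    [Module K V] [FiniteDimensional K V] {v : ι → V} {B : Finset ι}
    (hB : LinearIndepOn K v (B : Set ι)) (I : Finset ι) :
    #(B ∩ I) ≤ Module.finrank K (Submodule.span K (v '' (I : Set ι))) := by
  have h : LinearIndepOn K v ((B ∩ I : Finset ι) : Set ι) := hB.mono (by simp)
  have h2 : Module.finrank K (Submodule.span K (v '' ((B ∩ I : Finset ι) : Set ι))) = #(B ∩ I) := by
    rw [Set.image_eq_range]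
    exact (finrank_span_eq_card h).trans (Fintype.card_coe _)
  rw [← h2]
  exact Submodule.finrank_mono (Submodule.span_mono (Set.image_mono (by simp)))

open Finset in
theorem LinearIndepOn.exists_superset_card_eq_finrank {K V ι : Type*} [Field K] [AddCommGroup V]
    [Module K V] [FiniteDimensional K V] [Fintype ι] {v : ι → V}
    (hv : Submodule.span K (Set.range v) = ⊤) {s : Set ι} (hs : LinearIndepOn K v s) :
    ∃ B : Finset ι, s ⊆ B ∧ LinearIndepOn K v (B : Set ι) ∧ #B = Module.finrank K V := by
  obtain ⟨b, -, hsb, hspan, hb⟩ := exists_linearIndepOn_extension hs (Set.subset_univ s)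
  refine ⟨b.toFinset, by simpa using hsb, by simpa using hb, ?_⟩
  have htop : Submodule.span K (v '' b) = ⊤ := by
    rw [eq_top_iff, ← hv, Submodule.span_le, ← Set.image_univ]
    exact hspan
  have h := finrank_span_eq_card hb
  rw [← Set.image_eq_range, htop, finrank_top] at h
  rw [h, Set.toFinset_card]

open Finset in
/-- If `span (v '' I)` and `span (v '' Iᶜ)` meet nontrivially, then some basis taken from `v` meets
`I` in fewer than `rank I` elements. -/
theorem exists_basis_card_inter_lt_finrank_span {K V ι : Type*} [Field K] [AddCommGroup V]
    [Module K V] [FiniteDimensional K V] [Fintype ι] {v : ι → V}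
    (hv : Submodule.span K (Set.range v) = ⊤) (I : Finset ι)
    (hI : Submodule.span K (v '' (I : Set ι)) ⊓ Submodule.span K (v '' (I : Set ι)ᶜ) ≠ ⊥) :
    ∃ B : Finset ι, LinearIndepOn K v (B : Set ι) ∧ #B = Module.finrank K V ∧
      #(B ∩ I) < Module.finrank K (Submodule.span K (v '' (I : Set ι))) := by
  obtain ⟨c, hcI, -, hspan, hc⟩ := exists_linearIndepOn_extension
    (linearIndepOn_empty K v) (Set.empty_subset (I : Set ι)ᶜ)
  obtain ⟨B, hcB, hB, hcard⟩ := hc.exists_superset_card_eq_finrank hv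
  refine ⟨B, hB, hcard, ?_⟩
  have hrank : Module.finrank K (Submodule.span K (v '' (I : Set ι)ᶜ)) ≤ #(B \ I) := by
    have h1 : Submodule.span K (v '' (I : Set ι)ᶜ) ≤ Submodule.span K (v '' c) :=
      Submodule.span_le.2 hspan
    have h2 := finrank_span_eq_card hc
    rw [← Set.image_eq_range, ← Set.toFinset_card] at h2
    refine (Submodule.finrank_mono h1).trans (h2.le.trans (card_le_card fun i hi => ?_))
    have hi : i ∈ c := by simpa using hi
    exact mem_sdiff.2 ⟨by simpa using hcB hi, by simpa using hcI hi⟩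
  have hsup : Submodule.span K (v '' (I : Set ι)) ⊔ Submodule.span K (v '' (I : Set ι)ᶜ) = ⊤ := by
    rw [← Submodule.span_union, ← Set.image_union, Set.union_compl_self, Set.image_univ, hv]
  have hdim := Submodule.finrank_sup_add_finrank_inf_eq
    (Submodule.span K (v '' (I : Set ι))) (Submodule.span K (v '' (I : Set ι)ᶜ))
  rw [hsup, finrank_top] at hdim
  have hpos := Submodule.one_le_finrank_iff.2 hI
  have hadd := card_inter_add_card_sdiff B I
  omega

open Finset in
/-- The barycentre of the bases of an indecomposable family lies in the interior of its base
polytope. -/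
theorem exists_pos_sum_lt_finrank_span {K V ι : Type*} [Field K] [AddCommGroup V]
    [Module K V] [FiniteDimensional K V] [Fintype ι] {v : ι → V} (hne : ∀ i, v i ≠ 0)
    (hv : Submodule.span K (Set.range v) = ⊤)
    (hindec : ∀ I : Set ι, I.Nonempty → Iᶜ.Nonempty →
      Submodule.span K (v '' I) ⊓ Submodule.span K (v '' Iᶜ) ≠ ⊥) :
    ∃ β : ι → ℚ, (∀ i, 0 < β i) ∧ ∑ i, β i = Module.finrank K V ∧
      ∀ I : Finset ι, I.Nonempty → I ≠ univ →
        ∑ i ∈ I, β i < Module.finrank K (Submodule.span K (v '' (I : Set ι))) := by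
  set 𝓑 : Finset (Finset ι) :=
    {B | LinearIndepOn K v (B : Set ι) ∧ #B = Module.finrank K V} with h𝓑
  have mem {B : Finset ι} : B ∈ 𝓑 ↔ LinearIndepOn K v (B : Set ι) ∧ #B = Module.finrank K V := by
    simp [h𝓑]
  have hpos : (0 : ℚ) < #𝓑 := by
    obtain ⟨B, -, hB⟩ := (linearIndepOn_empty K v).exists_superset_card_eq_finrank hv
    exact_mod_cast card_pos.2 ⟨B, mem.2 hB⟩
  have hsum (I : Finset ι) : ∑ i ∈ I, (∑ B ∈ 𝓑, if i ∈ B then (1 : ℚ) else 0) / #𝓑 =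
      (∑ B ∈ 𝓑, (#(B ∩ I) : ℚ)) / #𝓑 := by
    rw [← sum_div, sum_comm]
    congr 1
    refine sum_congr rfl fun B _ => ?_
    rw [sum_boole, filter_mem_eq_inter, inter_comm]
  refine ⟨fun i => (∑ B ∈ 𝓑, if i ∈ B then (1 : ℚ) else 0) / #𝓑, fun i => ?_, ?_, ?_⟩
  · obtain ⟨B, hiB, hB⟩ :=
      (LinearIndepOn.singleton (R := K) (hne i)).exists_superset_card_eq_finrank hv
    refine div_pos (sum_pos' (fun B _ => by split_ifs <;> simp) ⟨B, mem.2 hB, ?_⟩) hpos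
    simp [show i ∈ B by simpa using hiB]
  · rw [hsum, div_eq_iff hpos.ne', sum_congr rfl fun B hB => by
      rw [inter_univ, (mem.1 hB).2], sum_const, nsmul_eq_mul, mul_comm]
  · intro I hI hI'
    rw [hsum, div_lt_iff₀ hpos, mul_comm, ← nsmul_eq_mul, ← sum_const]
    have hIc : (I : Set ι)ᶜ.Nonempty := by
      rw [Set.nonempty_compl]
      simpa using hI'
    obtain ⟨B, hB, hcard, hlt⟩ :=
      exists_basis_card_inter_lt_finrank_span hv I (hindec I (by simpa using hI) hIc)
    refine sum_lt_sum (fun B hB => ?_) ⟨B, mem.2 ⟨hB, hcard⟩, by exact_mod_cast hlt⟩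
    exact_mod_cast (mem.1 hB).1.card_inter_le_finrank_span I

open Filter Topology in
theorem Rat.eventually_add_mul_ne_intCast (a : ℚ) {c : ℚ} (hc : c ≠ 0) :
    ∀ᶠ ε in 𝓝[>] (0 : ℚ), ∀ m : ℤ, a + ε * c ≠ m := by
  have hlim : Tendsto (fun ε : ℚ => |ε * c| * a.den) (𝓝[>] 0) (𝓝 0) := by
    have : Continuous fun ε : ℚ => |ε * c| * a.den := by fun_prop
    simpa using (this.tendsto 0).mono_left nhdsWithin_le_nhds
  filter_upwards [hlim.eventually_lt_const one_pos, self_mem_nhdsWithin] with ε hε hpos m hm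
  have hden : (a.den : ℚ) ≠ 0 := by exact_mod_cast a.den_nz
  have hcast : ε * c * a.den = ((m * a.den - a.num : ℤ) : ℚ) := by
    push_cast
    rw [← hm, ← Rat.mul_den_eq_num a]
    ring
  have habs : |((m * a.den - a.num : ℤ) : ℚ)| < 1 := by
    rwa [← hcast, abs_mul, Nat.abs_cast]
  have hzero : m * a.den - a.num = 0 := Int.abs_lt_one_iff.1 (by exact_mod_cast habs)
  rw [hzero, Int.cast_zero] at hcast
  exact mul_ne_zero (mul_ne_zero (ne_of_gt hpos) hc) hden hcast

open Finset in
theorem exists_sum_eq_zero_forall_sum_ne_zero (ι : Type*) [Fintype ι] [Nonempty ι] :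
    ∃ d : ι → ℚ, ∑ i, d i = 0 ∧ ∀ I : Finset ι, I.Nonempty → I ≠ univ → ∑ i ∈ I, d i ≠ 0 := by
  obtain ⟨j⟩ := ‹Nonempty ι›
  have hsum (I : Finset ι) : ∑ i ∈ I, (1 - if i = j then (Fintype.card ι : ℚ) else 0) =
      #I - if j ∈ I then (Fintype.card ι : ℚ) else 0 := by
    simp [sum_sub_distrib]
  refine ⟨fun i => 1 - if i = j then (Fintype.card ι : ℚ) else 0, ?_, fun I hI hI' => ?_⟩
  · rw [hsum]
    simp
  · rw [hsum]
    split_ifs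
    · rw [sub_ne_zero]
      exact_mod_cast (card_lt_univ_of_notMem
        (x := (not_forall.1 (mt eq_univ_iff_forall.2 hI')).choose)
        (not_forall.1 (mt eq_univ_iff_forall.2 hI')).choose_spec).ne
    · simpa using hI.ne_empty

open Finset Filter Topology in
/-- Small perturbations inside the hyperplane of fixed total sum make every proper partial sum
non-integral while preserving strict upper bounds and positivity. -/
theorem exists_perturbation_forall_sum_ne_intCast {ι : Type*} [Fintype ι] [Nonempty ι]
    {β : ι → ℚ} (hβ : ∀ i, 0 < β i) {ρ : Finset ι → ℚ}
    (hρ : ∀ I : Finset ι, I.Nonempty → I ≠ univ → ∑ i ∈ I, β i < ρ I) :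
    ∃ γ : ι → ℚ, (∀ i, 0 < γ i) ∧ ∑ i, γ i = ∑ i, β i ∧
      ∀ I : Finset ι, I.Nonempty → I ≠ univ →
        ∑ i ∈ I, γ i < ρ I ∧ ∀ m : ℤ, ∑ i ∈ I, γ i ≠ m := by
  obtain ⟨d, hd, hd'⟩ := exists_sum_eq_zero_forall_sum_ne_zero ι
  have hsum (ε : ℚ) (I : Finset ι) :
      ∑ i ∈ I, (β i + ε * d i) = ∑ i ∈ I, β i + ε * ∑ i ∈ I, d i := by
    rw [sum_add_distrib, mul_sum]
  have hlim (a c : ℚ) : Tendsto (fun ε : ℚ => a + ε * c) (𝓝[>] 0) (𝓝 a) := by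
    have : Continuous fun ε : ℚ => a + ε * c := by fun_prop
    simpa using (this.tendsto 0).mono_left nhdsWithin_le_nhds
  have hpos : ∀ᶠ ε in 𝓝[>] (0 : ℚ), ∀ i, 0 < β i + ε * d i :=
    eventually_all.2 fun i => (hlim _ _).eventually_const_lt (hβ i)
  have hgen : ∀ᶠ ε in 𝓝[>] (0 : ℚ), ∀ I : Finset ι, I.Nonempty → I ≠ univ →
      ∑ i ∈ I, (β i + ε * d i) < ρ I ∧ ∀ m : ℤ, ∑ i ∈ I, (β i + ε * d i) ≠ m := by
    simp only [hsum]
    refine eventually_all.2 fun I => ?_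
    by_cases hI : I.Nonempty ∧ I ≠ univ
    · filter_upwards [(hlim _ _).eventually_lt_const (hρ I hI.1 hI.2),
        Rat.eventually_add_mul_ne_intCast _ (hd' I hI.1 hI.2)] with ε h1 h2 _ _
      exact ⟨h1, h2⟩
    · exact Eventually.of_forall fun ε h1 h2 => absurd ⟨h1, h2⟩ hI
  obtain ⟨ε, h1, h2⟩ := (hpos.and hgen).exists
  exact ⟨fun i => β i + ε * d i, h1, by rw [hsum, hd, mul_zero, add_zero], h2⟩

/-- Let `f₁,…,f_r` be nonzero linear functionals on `ℂⁿ` defining a central hyperplane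
arrangement which is essential and indecomposable.  Then there exists a vector
`β ∈ ℚ^r` adapted to the edge `{0}`: all `β i > 0`, `∑ i, β i = n`, for every dense edge `W`
one has `∑_{i : W ⊆ ker f_i} β i ≤ codim W`, and for every dense edge `W ≠ {0}` the sum
`∑_{i : W ⊆ ker f_i} β i` is not an integer. -/
theorem exists_vector_adapted_to_zero_edge
    (n r : ℕ) (hn : 0 < n)
    (f : Fin r → ((Fin n → ℂ) →ₗ[ℂ] ℂ))
    (hne : ∀ i, f i ≠ 0)
    (hess : Submodule.span ℂ (Set.range f) = ⊤)
    (hindec : ∀ I : Set (Fin r), I.Nonempty → Iᶜ.Nonempty →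
      Submodule.span ℂ (f '' I) ⊓ Submodule.span ℂ (f '' Iᶜ) ≠ ⊥) :
    ∃ β : Fin r → ℚ,
      (∀ i, 0 < β i) ∧
      (∑ i, β i = n) ∧
      (∀ W : Submodule ℂ (Fin n → ℂ),
        -- `W` is an edge
        (∃ S : Finset (Fin r), S.Nonempty ∧ W = ⨅ i ∈ S, LinearMap.ker (f i)) →
        -- `W` is dense: the subcollection `{f_i : W ⊆ ker f_i}` is indecomposable
        (∀ I : Set (Fin r), I ⊆ {i | W ≤ LinearMap.ker (f i)} → I.Nonempty →
          ({i | W ≤ LinearMap.ker (f i)} \ I).Nonempty →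
          Submodule.span ℂ (f '' I) ⊓
            Submodule.span ℂ (f '' ({i | W ≤ LinearMap.ker (f i)} \ I)) ≠ ⊥) →
        -- the two conclusions for the dense edge `W`
        ((∑ i ∈ Finset.univ.filter (fun i => W ≤ LinearMap.ker (f i)), β i)
            ≤ (n : ℚ) - (Module.finrank ℂ W : ℚ) ∧
          (W ≠ ⊥ →
            ∀ m : ℤ, (∑ i ∈ Finset.univ.filter (fun i => W ≤ LinearMap.ker (f i)), β i)
              ≠ (m : ℚ)))) := by
  obtain ⟨β, hβ, hβn, hβlt⟩ := exists_pos_sum_lt_finrank_span hne hess hindec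
  have hfin : Module.finrank ℂ ((Fin n → ℂ) →ₗ[ℂ] ℂ) = n := by
    rw [Module.finrank_linearMap]
    simp
  have : Nonempty (Fin r) := by
    by_contra hr
    rw [not_nonempty_iff] at hr
    rw [Fintype.sum_empty, hfin] at hβn
    exact hn.ne (by exact_mod_cast hβn)
  obtain ⟨γ, hγ, hγn, hγI⟩ := exists_perturbation_forall_sum_ne_intCast hβ hβlt
  rw [hβn, hfin] at hγn
  refine ⟨γ, hγ, hγn, fun W hW _ => ?_⟩
  set F : Finset (Fin r) := Finset.univ.filter (fun i => W ≤ LinearMap.ker (f i)) with hF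
  have hFne : F.Nonempty := by
    obtain ⟨S, ⟨i, hi⟩, rfl⟩ := hW
    exact ⟨i, by simpa [hF] using iInf₂_le i hi⟩
  have hspan : Submodule.span ℂ (f '' (F : Set (Fin r))) ≤ W.dualAnnihilator := by
    rw [Submodule.span_le]
    rintro _ ⟨i, hi, rfl⟩
    have hi : W ≤ LinearMap.ker (f i) := by simpa [hF] using hi
    exact (Submodule.mem_dualAnnihilator _).2 fun w hw => hi hw
  have hdim : Module.finrank ℂ W + Module.finrank ℂ W.dualAnnihilator = n := by
    rw [Subspace.finrank_add_finrank_dualAnnihilator_eq]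
    simp
  by_cases hbot : W = ⊥
  · refine ⟨?_, fun h => absurd hbot h⟩
    have : F = Finset.univ := by simp [hF, hbot]
    rw [this, hγn, hbot]
    simp
  · have hFuniv : F ≠ Finset.univ := by
      intro h
      rw [h, Finset.coe_univ, Set.image_univ, hess, top_le_iff] at hspan
      rw [hspan] at hdim
      have : Module.finrank ℂ (⊤ : Submodule ℂ (Module.Dual ℂ (Fin n → ℂ))) = n := by
        rw [finrank_top]
        exact hfin
      exact hbot (Submodule.finrank_eq_zero.1 (by omega))
    obtain ⟨hlt, hcast⟩ := hγI F hFne hFuniv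
    refine ⟨hlt.le.trans ?_, fun _ => hcast⟩
    rw [le_sub_iff_add_le']
    exact_mod_cast (Nat.add_le_add_left (Submodule.finrank_mono hspan) _).trans hdim.le
end
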